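/- arXiv:2205.00253 — 4 statements merged into one kernel-verified Lean document; each statement's English description precedes it below -/
import Mathlib

section
/- Let α be an irrational number of finite type at most τ, and let ϖ ∈ (0, 1/τ). Then there exists Q_0 > 0 (depending on α and ϖ) such that for every real Q ≥ Q_0 there exist integers a and q with gcd(a, q) = 1, Q^ϖ < q ≤ Q, and |α − a/q| < 1/(qQ). -/
open Filter Real

/-- Distance from a real number to the nearest integer. -/
noncomputable def nearInt (t : ℝ) : ℝ := ⨅ n : ℤ, |t - (n : ℝ)|

/-- An irrational number `α` is of finite type at most `τ` if for every `θ > τ`,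
`liminf_{q → ∞, q ∈ ℕ} q^θ ‖qα‖ > 0` (liminf taken in the extended reals). -/
def FiniteTypeAtMost (α τ : ℝ) : Prop :=
  ∀ θ : ℝ, τ < θ →
    (0 : EReal) < Filter.liminf
      (fun q : ℕ => (((q : ℝ) ^ θ * nearInt ((q : ℝ) * α) : ℝ) : EReal)) Filter.atTop

theorem nearInt_le (t : ℝ) (n : ℤ) : nearInt t ≤ |t - n| :=
  ciInf_le ⟨0, by rintro _ ⟨m, rfl⟩; exact abs_nonneg _⟩ n

theorem Irrational.nearInt_pos {t : ℝ} (ht : Irrational t) : 0 < nearInt t := by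
  have hround : 0 < |t - round t| := abs_pos.mpr (sub_ne_zero.mpr (ht.ne_int _))
  exact hround.trans_le (le_ciInf fun n => round_le t n)

/-- A sequence that is positive at positive indices and eventually bounded away from zero
is bounded away from zero at all positive indices. -/
theorem exists_pos_forall_le_of_eventually_le {f : ℕ → ℝ} {c : ℝ} (hc : 0 < c)
    (hpos : ∀ n, 0 < n → 0 < f n) (hf : ∀ᶠ n in atTop, c ≤ f n) :
    ∃ d > 0, ∀ n, 0 < n → d ≤ f n := by
  obtain ⟨N, hN⟩ := eventually_atTop.mp hf
  clear hf
  induction N generalizing c with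
  | zero => exact ⟨c, hc, fun n _ => hN n n.zero_le⟩
  | succ N ih =>
    rcases N.eq_zero_or_pos with rfl | hNpos
    · exact ⟨c, hc, fun n hn => hN n hn⟩
    · refine ih (lt_min hc (hpos N hNpos)) fun n hn => ?_
      rcases hn.eq_or_lt with rfl | hlt
      · exact min_le_right _ _
      · exact (min_le_left _ _).trans (hN n hlt)

theorem FiniteTypeAtMost.exists_pos_forall_le {α τ θ : ℝ} (htype : FiniteTypeAtMost α τ)
    (hirr : Irrational α) (hθ : τ < θ) :
    ∃ c > 0, ∀ q : ℕ, 0 < q → c ≤ (q : ℝ) ^ θ * nearInt (q * α) := by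
  obtain ⟨c, hc, hclim⟩ := EReal.lt_iff_exists_real_btwn.mp (htype θ hθ)
  refine exists_pos_forall_le_of_eventually_le (EReal.coe_pos.mp hc) (fun q hq => ?_) ?_
  · exact mul_pos (rpow_pos_of_pos (Nat.cast_pos.mpr hq) _)
      (hirr.natCast_mul hq.ne').nearInt_pos
  · filter_upwards [eventually_lt_of_lt_liminf hclim] with q hq
    exact (EReal.coe_lt_coe_iff.mp hq).le

/-- Dirichlet's approximation theorem with a real bound on the denominator. -/
theorem exists_rat_den_le_and_abs_sub_lt (ξ : ℝ) {Q : ℝ} (hQ : 1 ≤ Q) :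
    ∃ r : ℚ, (r.den : ℝ) ≤ Q ∧ |ξ - r| < 1 / (r.den * Q) := by
  obtain ⟨r, hr, hden⟩ := exists_rat_abs_sub_le_and_den_le ξ (Nat.floor_pos.mpr hQ)
  have hden_pos : (0 : ℝ) < r.den := Nat.cast_pos.mpr r.pos
  refine ⟨r, (Nat.le_floor_iff (by linarith)).mp hden, hr.trans_lt ?_⟩
  rw [mul_comm (r.den : ℝ)]
  exact one_div_lt_one_div_of_lt (by positivity)
    (mul_lt_mul_of_pos_right (Nat.lt_floor_add_one Q) hden_pos)

theorem dioph_approx_finite_type (α τ ϖ : ℝ)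
    (hirr : Irrational α) (htype : FiniteTypeAtMost α τ)
    (hϖ0 : 0 < ϖ) (hϖ1 : ϖ < 1 / τ) :
    ∃ Q₀ > 0, ∀ Q : ℝ, Q₀ ≤ Q →
      ∃ a q : ℤ, Int.gcd a q = 1 ∧ Q ^ ϖ < (q : ℝ) ∧ (q : ℝ) ≤ Q ∧
        |α - (a : ℝ) / q| < 1 / (q * Q) := by
  have hτ : 0 < τ := one_div_pos.mp (hϖ0.trans hϖ1)
  obtain ⟨θ, hτθ, hθϖ⟩ := exists_between ((lt_one_div hϖ0 hτ).mp hϖ1)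
  have hexp : 0 < 1 - ϖ * θ := by
    rw [lt_div_iff₀ hϖ0] at hθϖ
    linarith
  obtain ⟨c, hc, hbound⟩ := htype.exists_pos_forall_le hirr hτθ
  obtain ⟨Q₁, hQ₁⟩ := eventually_atTop.mp
    ((tendsto_rpow_neg_atTop hexp).eventually (gt_mem_nhds hc))
  refine ⟨max 1 Q₁, by positivity, fun Q hQ => ?_⟩
  have hQ1 : 1 ≤ Q := (le_max_left _ _).trans hQ
  have hQ0 : 0 < Q := by linarith
  obtain ⟨r, hrQ, hr⟩ := exists_rat_den_le_and_abs_sub_lt α hQ1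
  have hden : (0 : ℝ) < r.den := Nat.cast_pos.mpr r.pos
  refine ⟨r.num, r.den, by simpa [Int.gcd] using r.reduced, ?_, by simpa using hrQ, ?_⟩
  · rw [Int.cast_natCast]
    by_contra! hle
    have hnear : nearInt (r.den * α) < 1 / Q := by
      refine (nearInt_le _ r.num).trans_lt ?_
      have hfactor : (r.den : ℝ) * α - r.num = r.den * (α - r) := by
        rw [mul_sub, mul_comm _ (r : ℝ)]
        congr 1
        exact_mod_cast (Rat.mul_den_eq_num r).symm
      rw [hfactor, abs_mul, abs_of_pos hden]
      calc (r.den : ℝ) * |α - r| < r.den * (1 / (r.den * Q)) := by gcongr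
        _ = 1 / Q := by field_simp
    have hpow : (r.den : ℝ) ^ θ ≤ Q ^ (ϖ * θ) := by
      rw [rpow_mul hQ0.le]
      exact rpow_le_rpow hden.le hle (hτ.trans hτθ).le
    refine lt_irrefl c ?_
    calc c ≤ (r.den : ℝ) ^ θ * nearInt (r.den * α) := hbound _ r.pos
      _ ≤ (r.den : ℝ) ^ θ * (1 / Q) := by gcongr
      _ ≤ Q ^ (ϖ * θ) * (1 / Q) := by gcongr
      _ = Q ^ (-(1 - ϖ * θ)) := by
        rw [neg_sub, rpow_sub_one hQ0.ne', mul_one_div]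
      _ < c := hQ₁ Q ((le_max_right _ _).trans hQ)
  · simpa [← Rat.cast_def] using hr
end

section
/- Let k ≥ 1, let 1 = m_1 < m_2 < ⋯ < m_k be integers, and let α_1, …, α_k be arbitrary real numbers. Then for every real x ≥ 1, the number of positive integers n ≤ x satisfying gcd(n, ⌊α_1 n^{m_1}⌋, …, ⌊α_k n^{m_k}⌋) = 1 equals ∑_{d=1}^{⌊x⌋} μ(d) · #{ n ∈ ℕ, 1 ≤ n ≤ x/d : {α_j d^{m_j−1} n^{m_j}} < 1/d for all j = 1, …, k }, where μ is the Möbius function. -/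
open Real

theorem natCast_dvd_floor_iff_fract_div_lt (t : ℝ) {d : ℕ} (hd : 0 < d) :
    (d : ℤ) ∣ ⌊t⌋ ↔ Int.fract (t / d) < 1 / (d : ℝ) := by
  have hd' : (0 : ℝ) < d := by exact_mod_cast hd
  have hd1 : (1 : ℝ) ≤ d := by exact_mod_cast hd
  constructor
  · rintro ⟨q, hq⟩
    have ht : (⌊t⌋ : ℝ) = d * q := by exact_mod_cast hq
    have hfloor : ⌊t / d⌋ = q := by
      rw [Int.floor_eq_iff, le_div_iff₀ hd', div_lt_iff₀ hd']
      constructor <;> linarith [Int.floor_le t, Int.lt_floor_add_one t]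
    rw [Int.fract, hfloor, lt_div_iff₀ hd', sub_mul, div_mul_cancel₀ _ hd'.ne']
    linarith [Int.lt_floor_add_one t]
  · intro h
    refine ⟨⌊t / d⌋, ?_⟩
    have h0 := Int.fract_nonneg (t / d)
    rw [Int.fract] at h h0
    rw [lt_div_iff₀ hd', sub_mul, div_mul_cancel₀ _ hd'.ne'] at h
    have h1 := mul_nonneg h0 hd'.le
    rw [sub_mul, div_mul_cancel₀ _ hd'.ne'] at h1
    rw [Int.floor_eq_iff]
    push_cast
    constructor <;> linarith

theorem sum_divisors_moebius (n : ℕ) :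
    ∑ d ∈ n.divisors, ArithmeticFunction.moebius d = if n = 1 then 1 else 0 := by
  rw [← ArithmeticFunction.coe_mul_zeta_apply, ArithmeticFunction.moebius_mul_coe_zeta,
    ArithmeticFunction.one_apply]

theorem card_filter_eq_one_eq_sum_moebius (N : ℕ) (f : ℕ → ℕ) (hf : ∀ n, f n ∣ n) :
    (((Finset.Icc 1 N).filter fun n => f n = 1).card : ℤ) =
      ∑ d ∈ Finset.Icc 1 N, ArithmeticFunction.moebius d *
        (((Finset.Icc 1 N).filter fun n => d ∣ f n).card : ℤ) := by
  simp_rw [Finset.card_filter, Nat.cast_sum, Finset.mul_sum]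
  rw [Finset.sum_comm]
  refine Finset.sum_congr rfl fun n hn => ?_
  obtain ⟨hn1, hnN⟩ := Finset.mem_Icc.mp hn
  have hpos : 0 < f n := Nat.pos_of_dvd_of_pos (hf n) hn1
  have hdiv : (f n).divisors = (Finset.Icc 1 N).filter fun d => d ∣ f n := by
    ext d
    simp only [Nat.mem_divisors, Finset.mem_filter, Finset.mem_Icc]
    refine ⟨fun h => ⟨⟨Nat.pos_of_dvd_of_pos h.1 hpos, ?_⟩, h.1⟩, fun h => ⟨h.2, hpos.ne'⟩⟩
    exact (Nat.le_of_dvd hn1 (h.1.trans (hf n))).trans hnN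
  simp only [Nat.cast_ite, Nat.cast_one, Nat.cast_zero, mul_ite, mul_one, mul_zero]
  rw [← Finset.sum_filter, ← hdiv, sum_divisors_moebius]

theorem card_filter_Icc_eq_card_filter_Icc_div (N : ℕ) {d : ℕ} (hd : 0 < d) (p : ℕ → Prop)
    [DecidablePred p] (hp : ∀ n, p n → d ∣ n) :
    ((Finset.Icc 1 N).filter p).card =
      ((Finset.Icc 1 (N / d)).filter fun n => p (d * n)).card := by
  symm
  refine Finset.card_bij (fun n _ => d * n) ?_ ?_ ?_
  · intro n hn
    simp only [Finset.mem_filter, Finset.mem_Icc, Nat.le_div_iff_mul_le hd] at hn ⊢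
    exact ⟨⟨Nat.mul_pos hd hn.1.1, by linarith [mul_comm n d]⟩, hn.2⟩
  · intro a _ b _ h
    exact Nat.eq_of_mul_eq_mul_left hd h
  · intro n hn
    simp only [Finset.mem_filter, Finset.mem_Icc] at hn
    obtain ⟨c, rfl⟩ := hp n hn.2
    refine ⟨c, ?_, rfl⟩
    simp only [Finset.mem_filter, Finset.mem_Icc, Nat.le_div_iff_mul_le hd]
    exact ⟨⟨Nat.pos_of_mul_pos_left hn.1.1, by linarith [mul_comm c d]⟩, hn.2⟩

theorem moebius_inversion_gcd_count (k : ℕ) (hk : 1 ≤ k) (m : Fin k → ℕ)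
    (hmono : StrictMono m) (hm1 : m ⟨0, by omega⟩ = 1)
    (α : Fin k → ℝ) (x : ℝ) (hx : 1 ≤ x) :
    ((((Finset.Icc 1 ⌊x⌋₊).filter fun n : ℕ =>
        Int.gcd (n : ℤ)
          (Finset.univ.gcd fun j : Fin k => ⌊α j * (n : ℝ) ^ (m j)⌋) = 1).card : ℤ)) =
      ∑ d ∈ Finset.Icc 1 ⌊x⌋₊, (ArithmeticFunction.moebius d) *
        (((Finset.Icc 1 ⌊x / (d : ℝ)⌋₊).filter fun n : ℕ =>
          ∀ j : Fin k,
            Int.fract (α j * (d : ℝ) ^ (m j - 1) * (n : ℝ) ^ (m j)) < 1 / (d : ℝ)).card : ℤ) := by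
  have hm : ∀ j, 1 ≤ m j := fun j => hm1 ▸ hmono.monotone (Fin.mk_le_of_le_val (Nat.zero_le _))
  have hgcd : ∀ n : ℕ, Int.gcd (n : ℤ)
      (Finset.univ.gcd fun j : Fin k => ⌊α j * (n : ℝ) ^ (m j)⌋) ∣ n := fun n => by
    exact_mod_cast Int.gcd_dvd_left (n : ℤ) _
  rw [card_filter_eq_one_eq_sum_moebius _ _ hgcd]
  refine Finset.sum_congr rfl fun d hd => ?_
  have hd0 : 0 < d := (Finset.mem_Icc.mp hd).1
  rw [card_filter_Icc_eq_card_filter_Icc_div _ hd0 _ fun n hn => hn.trans (hgcd n),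
    Nat.floor_div_natCast]
  congr 3
  refine Finset.filter_congr fun n _ => ?_
  have hd' : (d : ℝ) ≠ 0 := by exact_mod_cast hd0.ne'
  rw [Int.dvd_gcd_iff, Finset.dvd_gcd_iff,
    and_iff_right (Int.natCast_dvd_natCast.mpr (dvd_mul_right d n))]
  simp only [Finset.mem_univ, true_imp_iff]
  refine forall_congr' fun j => ?_
  rw [natCast_dvd_floor_iff_fract_div_lt _ hd0]
  have hquot : α j * ((d * n : ℕ) : ℝ) ^ m j / d =
      α j * (d : ℝ) ^ (m j - 1) * (n : ℝ) ^ m j := by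
    rw [div_eq_iff hd', Nat.cast_mul, mul_pow, ← pow_sub_one_mul (Nat.one_le_iff_ne_zero.mp (hm j))]
    ring
  rw [hquot]
end

section
/- Let α be a real number, let x ≥ 1 and Q > 0 be real, and let a, q, d be integers with q ≥ 1, gcd(a, q) = 1, |α − a/q| < 1/(qQ), d ≥ 2q, and d ≥ 2x/Q. Then every positive integer n ≤ x/d for which d divides ⌊αdn⌋ is divisible by q; consequently, #{ n ∈ ℕ, 1 ≤ n ≤ x/d : d divides ⌊αdn⌋ } ≤ x/(dq). -/
open Real

/-- If `α` is close to `a / q` and `n` is small, then `d ∣ ⌊α d n⌋` forces `q ∣ n`. -/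
theorem dvd_of_dvd_floor_mul {α x Q : ℝ} (hQ : 0 < Q) {a q d : ℤ} (hq : 1 ≤ q)
    (hgcd : Int.gcd a q = 1) (happrox : |α - (a : ℝ) / q| < 1 / (q * Q))
    (hd1 : 2 * q ≤ d) (hd2 : 2 * x / Q ≤ (d : ℝ)) {n : ℕ} (hn : 1 ≤ n)
    (hnx : (n : ℝ) ≤ x / d) (hdvd : d ∣ ⌊α * d * n⌋) : q ∣ (n : ℤ) := by
  obtain ⟨m, hm⟩ := hdvd
  have hq0 : (0 : ℝ) < q := by exact_mod_cast hq
  have hd1' : (2 : ℝ) * q ≤ d := by exact_mod_cast hd1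
  have hd0 : (0 : ℝ) < d := by linarith
  have hn0 : (0 : ℝ) < n := by exact_mod_cast hn
  have hlower := Int.floor_le (α * d * n)
  have hupper := Int.lt_floor_add_one (α * d * n)
  rw [hm] at hlower hupper
  push_cast at hlower hupper
  rw [le_div_iff₀ hd0] at hnx
  rw [div_le_iff₀ hQ] at hd2
  have hnQ : 2 * (n : ℝ) ≤ Q := by
    refine le_of_mul_le_mul_right ?_ hd0
    linarith
  have hclose : |q * α - a| * Q < 1 := by
    rw [lt_div_iff₀ (by positivity)] at happrox
    have heq : (q : ℝ) * α - a = q * (α - a / q) := by field_simp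
    rw [heq, abs_mul, abs_of_pos hq0]
    linarith
  have hnear : 2 * |n * (q * α - a)| < 1 := by
    rw [abs_mul, abs_of_pos hn0]
    nlinarith [abs_nonneg (q * α - a)]
  have hfrac_nonneg : 0 ≤ α * n - m := by
    refine le_of_mul_le_mul_left ?_ hd0
    linarith
  have hfrac_lt : 2 * (q * (α * n - m)) < 1 := by
    nlinarith
  have hfrac_nonneg' : 0 ≤ q * (α * n - m) := by positivity
  have habs := abs_lt.mp (show |n * (q * α - a)| < 1 / 2 by linarith)
  have h₁ : a * n - m * q < 1 := by
    have : (a * n - m * q : ℝ) < 1 := by linarith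
    exact_mod_cast this
  have h₂ : -1 < a * n - m * q := by
    have : (-1 : ℝ) < a * n - m * q := by linarith
    exact_mod_cast this
  have hdiv : q ∣ a * n := ⟨m, by linarith [show a * n - m * q = 0 by omega]⟩
  exact (Int.isCoprime_iff_gcd_eq_one.mpr hgcd).symm.dvd_of_dvd_mul_left hdiv

theorem large_d_divisibility (α x Q : ℝ) (hx : 1 ≤ x) (hQ : 0 < Q)
    (a q d : ℤ) (hq : 1 ≤ q) (hgcd : Int.gcd a q = 1)
    (happrox : |α - (a : ℝ) / q| < 1 / (q * Q))
    (hd1 : 2 * q ≤ d) (hd2 : 2 * x / Q ≤ (d : ℝ)) :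
    (∀ n : ℕ, 1 ≤ n → (n : ℝ) ≤ x / d → d ∣ ⌊α * d * n⌋ → q ∣ (n : ℤ)) ∧
      ((((Finset.Icc 1 ⌊x / (d : ℝ)⌋₊).filter fun n : ℕ =>
          d ∣ ⌊α * d * n⌋).card : ℝ) ≤ x / (d * q)) := by
  have hdvd : ∀ n : ℕ, 1 ≤ n → (n : ℝ) ≤ x / d → d ∣ ⌊α * d * n⌋ → q ∣ (n : ℤ) :=
    fun n hn hnx => dvd_of_dvd_floor_mul hQ hq hgcd happrox hd1 hd2 hn hnx
  refine ⟨hdvd, ?_⟩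
  have hd0 : (0 : ℝ) < d := by exact_mod_cast (by omega : 0 < d)
  have hxd : 0 ≤ x / d := by positivity
  lift q to ℕ using by omega
  have hsub : ((Finset.Icc 1 ⌊x / (d : ℝ)⌋₊).filter fun n : ℕ => d ∣ ⌊α * d * n⌋) ⊆
      (Finset.Ioc 0 ⌊x / (d : ℝ)⌋₊).filter fun n : ℕ => q ∣ n := by
    intro n hn
    simp only [Finset.mem_filter, Finset.mem_Icc, Finset.mem_Ioc] at hn ⊢
    obtain ⟨⟨hn₁, hn₂⟩, hn₃⟩ := hn
    exact ⟨⟨hn₁, hn₂⟩, Int.natCast_dvd_natCast.mp (hdvd n hn₁ ((Nat.le_floor_iff hxd).mp hn₂) hn₃)⟩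
  have hcard := Finset.card_le_card hsub
  rw [Nat.Ioc_filter_dvd_card_eq_div] at hcard
  calc _ ≤ ((⌊x / (d : ℝ)⌋₊ / q : ℕ) : ℝ) := by exact_mod_cast hcard
    _ ≤ (⌊x / (d : ℝ)⌋₊ : ℝ) / q := Nat.cast_div_le
    _ ≤ x / d / q := by gcongr; exact Nat.floor_le hxd
    _ = x / (d * (q : ℤ)) := by rw [div_div, Int.cast_natCast]
end

section
/- There is an absolute constant C > 0 with the following property. Let α be a real number, let x ≥ 1 and Q ≥ 1 be real, and let a, q be integers with 1 ≤ q ≤ Q, gcd(a, q) = 1, and |α − a/q| < 1/(qQ). Then for every positive integer d, #{ n ∈ ℕ, 1 ≤ n ≤ x/d : d divides ⌊αdn⌋ } ≤ C·( x/d² + x²/(d²qQ) + Q/d + x/(dQ) + x/(dq) ). -/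
/-- If `d` divides `⌊α d n⌋`, then `α n` exceeds some integer by less than `1 / d`. -/
theorem exists_int_sub_mem_of_dvd_floor {α : ℝ} {d n : ℕ} (hd : 0 < d)
    (h : (d : ℤ) ∣ ⌊α * d * n⌋) : ∃ m : ℤ, 0 ≤ α * n - m ∧ d * (α * n - m) < 1 := by
  obtain ⟨m, hm⟩ := h
  have hd' : (0 : ℝ) < d := by exact_mod_cast hd
  have h1 := Int.floor_le (α * d * n)
  have h2 := Int.lt_floor_add_one (α * d * n)
  rw [hm] at h1 h2
  push_cast at h1 h2
  refine ⟨m, ?_, by linarith⟩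
  by_contra! hneg
  nlinarith

/-- If `q` does not divide `n`, then `a n / q` is at distance at least `1 / q` from the integers;
hence `α n` can be within `1 / d` of an integer only if `d` is not large or `n` is large. -/
theorem one_le_of_near_int {α Q : ℝ} (hQ : 1 ≤ Q) {a : ℤ} {q d n : ℕ} (hq : 0 < q)
    (hqQ : (q : ℝ) ≤ Q) (hco : IsCoprime (q : ℤ) a) (hα : |q * α - a| * Q < 1)
    (hd : 0 < d) (hn : 0 < n) {m : ℤ} (h0 : 0 ≤ α * n - m) (h1 : d * (α * n - m) < 1) :
    1 ≤ Q / d + n / Q + n / q := by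
  have hd' : (0 : ℝ) < d := by exact_mod_cast hd
  have hq' : (0 : ℝ) < q := by exact_mod_cast hq
  have hQ' : (0 : ℝ) < Q := by linarith
  by_cases hz : a * n - q * m = 0
  · have hqn : (q : ℤ) ∣ n := hco.dvd_of_dvd_mul_left ⟨m, by linarith⟩
    have hle : q ≤ n := Nat.le_of_dvd hn (by exact_mod_cast hqn)
    have : (1 : ℝ) ≤ n / q := by
      rw [one_le_div hq']
      exact_mod_cast hle
    have : 0 ≤ Q / d := by positivity
    have : 0 ≤ n / Q := by positivity
    linarith
  · have habs : (1 : ℝ) ≤ |(a : ℝ) * n - q * m| := by exact_mod_cast Int.one_le_abs hz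
    have heq : (a : ℝ) * n - q * m = q * (α * n - m) - (q * α - a) * n := by ring
    have htri : |(a : ℝ) * n - q * m| ≤ q * (α * n - m) + |q * α - a| * n := by
      rw [heq]
      refine (abs_sub _ _).trans_eq ?_
      rw [abs_of_nonneg (by positivity), abs_mul, Nat.abs_cast]
    have hδ : |q * α - a| * n ≤ n / Q := by
      rw [le_div_iff₀ hQ']
      nlinarith [(Nat.cast_nonneg n : (0 : ℝ) ≤ n)]
    have hθ : q * (α * n - m) ≤ Q / d := by
      rw [le_div_iff₀ hd']
      nlinarith
    have : (0 : ℝ) ≤ n / q := by positivity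
    linarith

/-- The integers `n ≤ M` for which `α n` exceeds an integer by less than `1 / d`, counted
by blocks of length `q`. -/
theorem card_near_int_le {α Q : ℝ} {a : ℤ} {q d M : ℕ} (hq : 0 < q)
    (hqQ : (q : ℝ) ≤ Q) (hco : IsCoprime (q : ℤ) a) (hα : |q * α - a| * Q < 1)
    (hd : 0 < d) (s : Finset ℕ) (hs : ∀ n ∈ s, n ≤ M) (m : ℕ → ℤ)
    (h0 : ∀ n ∈ s, 0 ≤ α * n - m n) (h1 : ∀ n ∈ s, d * (α * n - m n) < 1) :
    (s.card : ℝ) ≤ ((M : ℝ) / q + 1) * ((q : ℝ) / d + 4) := by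
  have hd' : (0 : ℝ) < d := by exact_mod_cast hd
  have hq' : (0 : ℝ) < q := by exact_mod_cast hq
  let c : ℕ → ℤ := fun b ↦ ⌊(q * α - a) * (q * b)⌋
  let f : ℕ → ℕ × ℤ := fun n ↦ (n / q, a * n - q * m n + c (n / q))
  let t : Finset (ℕ × ℤ) := Finset.range (M / q + 1) ×ˢ Finset.Icc (-2) ⌊(q : ℝ) / d + 1⌋
  have hmaps : ∀ n ∈ s, f n ∈ t := by
    intro n hn
    have hdiv : (q : ℝ) * (n / q : ℕ) + (n % q : ℕ) = n := by exact_mod_cast Nat.div_add_mod n q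
    have hmod : ((n % q : ℕ) : ℝ) ≤ q := by exact_mod_cast (Nat.mod_lt n hq).le
    have hmod0 : (0 : ℝ) ≤ (n % q : ℕ) := Nat.cast_nonneg _
    have hj : |(q * α - a) * (n % q : ℕ)| ≤ 1 := by
      rw [abs_mul, Nat.abs_cast]
      nlinarith [abs_nonneg (q * α - a)]
    have heq : (a : ℝ) * n - q * m n + (q * α - a) * (q * (n / q : ℕ))
        = q * (α * n - m n) - (q * α - a) * (n % q : ℕ) := by
      linear_combination (q * α - a) * hdiv
    obtain ⟨hj1, hj2⟩ := abs_le.1 hj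
    have hfl := Int.floor_le ((q * α - a) * (q * (n / q : ℕ)) : ℝ)
    have hfl' := Int.lt_floor_add_one ((q * α - a) * (q * (n / q : ℕ)) : ℝ)
    have hθ0 : 0 ≤ q * (α * n - m n) := mul_nonneg hq'.le (h0 n hn)
    have hθ : q * (α * n - m n) ≤ q / d := by
      rw [le_div_iff₀ hd']
      nlinarith [h1 n hn]
    simp only [t, f, c, Finset.mem_product, Finset.mem_range, Finset.mem_Icc]
    refine ⟨Nat.lt_succ_of_le (Nat.div_le_div_right (hs n hn)), ?_, ?_⟩
    · rify
      linarith
    · rw [Int.le_floor]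
      push_cast
      linarith
  have hinj : Set.InjOn f s := by
    intro n _ k _ hnk
    obtain ⟨hb, hc⟩ := Prod.mk.inj hnk
    rw [hb] at hc
    have hdvd : (q : ℤ) ∣ (n : ℤ) - k :=
      hco.dvd_of_dvd_mul_left ⟨m n - m k, by linarith⟩
    have hmod : k % q = n % q :=
      (Nat.modEq_iff_dvd (n := q) (a := k) (b := n)).2 hdvd
    rw [← Nat.div_add_mod n q, ← Nat.div_add_mod k q, hb, hmod]
  have hcard : s.card ≤ t.card := Finset.card_le_card_of_injOn f hmaps hinj
  have hfloor : (-2 : ℤ) ≤ ⌊(q : ℝ) / d + 1⌋ + 1 := by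
    have : 0 ≤ ⌊(q : ℝ) / d + 1⌋ := Int.floor_nonneg.2 (by positivity)
    linarith
  have hIcc : ((Finset.Icc (-2) ⌊(q : ℝ) / d + 1⌋).card : ℝ) ≤ q / d + 4 := by
    have h := Int.card_Icc_of_le (-2) ⌊(q : ℝ) / d + 1⌋ hfloor
    have h' : ((Finset.Icc (-2) ⌊(q : ℝ) / d + 1⌋).card : ℝ) = ⌊(q : ℝ) / d + 1⌋ + 1 - (-2) := by
      exact_mod_cast h
    have := Int.floor_le ((q : ℝ) / d + 1)
    linarith
  calc (s.card : ℝ) ≤ t.card := by exact_mod_cast hcard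
    _ = ((M / q : ℕ) + 1) * ((Finset.Icc (-2) ⌊(q : ℝ) / d + 1⌋).card : ℝ) := by
      simp only [t, Finset.card_product, Finset.card_range]
      push_cast
      rfl
    _ ≤ _ := by
      gcongr
      exact Nat.cast_div_le

theorem large_d_count_bound :
    ∃ C > 0, ∀ α x Q : ℝ, 1 ≤ x → 1 ≤ Q → ∀ a q : ℤ,
      1 ≤ q → (q : ℝ) ≤ Q → Int.gcd a q = 1 → |α - (a : ℝ) / q| < 1 / (q * Q) →
      ∀ d : ℕ, 0 < d →
        ((((Finset.Icc 1 ⌊x / (d : ℝ)⌋₊).filter fun n : ℕ =>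
            (d : ℤ) ∣ ⌊α * d * n⌋).card : ℝ)
          ≤ C * (x / (d : ℝ) ^ 2 + x ^ 2 / ((d : ℝ) ^ 2 * q * Q) + Q / d + x / (d * Q)
              + x / (d * q))) := by
  refine ⟨8, by norm_num, ?_⟩
  intro α x Q hx hQ a q hq hqQ hgcd hα d hd
  lift q to ℕ using by linarith
  simp only [Int.cast_natCast] at *
  have hq : 0 < q := by exact_mod_cast hq
  have hd' : (0 : ℝ) < d := by exact_mod_cast hd
  have hq' : (0 : ℝ) < q := by exact_mod_cast hq
  have hQ' : (0 : ℝ) < Q := by linarith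
  have hco : IsCoprime (q : ℤ) a := (Int.isCoprime_iff_gcd_eq_one.2 hgcd).symm
  have hα' : |q * α - a| * Q < 1 := by
    have heq : (q : ℝ) * α - a = q * (α - a / q) := by field_simp
    rw [lt_div_iff₀ (by positivity)] at hα
    rw [heq, abs_mul, Nat.abs_cast]
    linarith
  set s := (Finset.Icc 1 ⌊x / (d : ℝ)⌋₊).filter fun n : ℕ => (d : ℤ) ∣ ⌊α * d * n⌋ with hs
  have hmem : ∀ n ∈ s, 0 < n ∧ n ≤ ⌊x / (d : ℝ)⌋₊ ∧ (d : ℤ) ∣ ⌊α * d * n⌋ := by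
    intro n hn
    simp only [hs, Finset.mem_filter, Finset.mem_Icc] at hn
    exact ⟨hn.1.1, hn.1.2, hn.2⟩
  have hM : (⌊x / (d : ℝ)⌋₊ : ℝ) ≤ x / d := Nat.floor_le (by positivity)
  have ht1 : 0 ≤ x / (d : ℝ) ^ 2 := by positivity
  have ht2 : 0 ≤ x ^ 2 / ((d : ℝ) ^ 2 * q * Q) := by positivity
  have ht3 : 0 ≤ Q / d := by positivity
  have ht4 : 0 ≤ x / (d * Q) := by positivity
  have ht5 : 0 ≤ x / (d * q : ℝ) := by positivity
  obtain hempty | ⟨n, hn⟩ := s.eq_empty_or_nonempty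
  · rw [hempty, Finset.card_empty, Nat.cast_zero]
    positivity
  have hS : 1 ≤ Q / d + x / (d * Q) + x / (d * q) := by
    obtain ⟨hn0, hnM, hdvd⟩ := hmem n hn
    obtain ⟨m, h0, h1⟩ := exists_int_sub_mem_of_dvd_floor hd hdvd
    have hnx : (n : ℝ) ≤ x / d := le_trans (by exact_mod_cast hnM) hM
    refine (one_le_of_near_int hQ hq hqQ hco hα' hd hn0 h0 h1).trans ?_
    rw [← div_div, ← div_div]
    gcongr
  have hex : ∀ n : ℕ, ∃ m : ℤ, n ∈ s → 0 ≤ α * n - m ∧ d * (α * n - m) < 1 := by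
    intro n
    by_cases hn : n ∈ s
    · obtain ⟨m, hm⟩ := exists_int_sub_mem_of_dvd_floor hd (hmem n hn).2.2
      exact ⟨m, fun _ ↦ hm⟩
    · exact ⟨0, fun h ↦ absurd h hn⟩
  choose m hm using hex
  have hcard := card_near_int_le hq hqQ hco hα' hd s (fun n hn ↦ (hmem n hn).2.1) m
    (fun n hn ↦ (hm n hn).1) (fun n hn ↦ (hm n hn).2)
  have hmono : ((⌊x / (d : ℝ)⌋₊ : ℝ) / q + 1) * ((q : ℝ) / d + 4)
      ≤ (x / d / q + 1) * (q / d + 4) := by gcongr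
  have hexp : (x / d / q + 1) * ((q : ℝ) / d + 4)
      = x / (d : ℝ) ^ 2 + 4 * (x / (d * q)) + q / d + 4 := by
    field_simp
    ring
  have hqd : (q : ℝ) / d ≤ Q / d := by gcongr
  linarith
end
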